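/- Let θ₁, θ₂ ∈ ℝ^d, let x₁, …, x_n ∈ ℝ^d, and let λ > 0. Set u = max_{1≤i≤n} |x_iᵀ(θ₁ − θ₂)| (u = 0 if n = 0). Define α(x,θ₁,θ₂) = ∫₀¹ μ̇(xᵀθ₁ + v·xᵀ(θ₂ − θ₁)) dv and α̃(x,θ₁,θ₂) = ∫₀¹ (1−v)·μ̇(xᵀθ₁ + v·xᵀ(θ₂ − θ₁)) dv, and the matrices G = λI + Σᵢ α(x_i,θ₁,θ₂) x_i x_iᵀ, G̃ = λI + Σᵢ α̃(x_i,θ₁,θ₂) x_i x_iᵀ, and H(θ) = λI + Σᵢ μ̇(x_iᵀθ) x_i x_iᵀ. Then G ⪰ (1 + 2u)^{-1} H(θ) for each θ ∈ {θ₁, θ₂}, and G̃ ⪰ (2 + 2u)^{-1} H(θ₁). -/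

import Mathlib

open Matrix

/-- The logistic (sigmoid) function `μ(x) = 1/(1+exp(−x))`. -/
noncomputable def logistic (x : ℝ) : ℝ := (1 + Real.exp (-x))⁻¹

/-- `μ̇`, the derivative of the logistic function. -/
noncomputable def logisticDeriv : ℝ → ℝ := deriv logistic

theorem logisticDeriv_eq (z : ℝ) :
    logisticDeriv z = Real.exp (-z) / (1 + Real.exp (-z)) ^ 2 := by
  have hpos : 1 + Real.exp (-z) ≠ 0 := by positivity
  have h : HasDerivAt logistic (-(Real.exp (-z) * -1) / (1 + Real.exp (-z)) ^ 2) z :=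
    (((hasDerivAt_neg z).exp).const_add 1).inv hpos
  rw [logisticDeriv, h.deriv]
  ring

theorem continuous_logisticDeriv : Continuous logisticDeriv := by
  rw [funext logisticDeriv_eq]
  exact Continuous.div (by fun_prop) (by fun_prop) fun z => by positivity

theorem logisticDeriv_nonneg (z : ℝ) : 0 ≤ logisticDeriv z := by
  rw [logisticDeriv_eq]
  positivity

/-- Self-concordance of the logistic function, in integrated form. -/
theorem exp_neg_abs_mul_logisticDeriv_le (z t : ℝ) :
    Real.exp (-|t|) * logisticDeriv z ≤ logisticDeriv (z + t) := by
  simp only [logisticDeriv_eq, neg_add, Real.exp_add]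
  have ha := Real.exp_pos (-z)
  set a := Real.exp (-z)
  rw [mul_div_assoc', div_le_div_iff₀ (by positivity) (by positivity)]
  rcases le_total 0 t with ht | ht
  · rw [abs_of_nonneg ht, mul_comm a]
    have hs := Real.exp_pos (-t)
    have hs1 : Real.exp (-t) ≤ 1 := Real.exp_le_one_iff.2 (by linarith)
    have : Real.exp (-t) * a ≤ a := mul_le_of_le_one_left ha.le hs1
    gcongr
  · rw [abs_of_nonpos ht, neg_neg]
    have hs := Real.exp_pos (-t)
    have hr := Real.exp_pos t
    have hs1 : Real.exp t ≤ 1 := Real.exp_le_one_iff.2 ht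
    have hrs : Real.exp t * Real.exp (-t) = 1 := by rw [← Real.exp_add]; simp
    set r := Real.exp t
    set s := Real.exp (-t)
    have h1 : r * (1 + a * s) ≤ 1 + a := by nlinarith
    calc r * a * (1 + a * s) ^ 2 = a * s * (r * (1 + a * s)) ^ 2 := by
          linear_combination (-(a * r * (1 + a * s) ^ 2)) * hrs
      _ ≤ a * s * (1 + a) ^ 2 := by gcongr

/-- The average of `exp (-v w)` over the unit interval is at least `1 / (1 + w)`. -/
theorem one_le_mul_integral_exp (w : ℝ) (hw : 0 ≤ w) :
    1 ≤ (1 + w) * ∫ v in (0 : ℝ)..1, Real.exp (-(v * w)) := by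
  have hd (v : ℝ) : HasDerivAt (fun v => v * Real.exp (-w) - Real.exp (-(v * w)))
      (Real.exp (-w) + w * Real.exp (-(v * w))) v := by
    refine (((hasDerivAt_id v).mul_const (Real.exp (-w))).sub
      (((hasDerivAt_id v).mul_const w).neg.exp)).congr_deriv ?_
    simp only [Pi.neg_apply, id_eq]
    ring
  have hint := intervalIntegral.integral_eq_sub_of_hasDerivAt (a := 0) (b := 1)
    (fun v _ => hd v) (Continuous.intervalIntegrable (by fun_prop) _ _)
  rw [← intervalIntegral.integral_const_mul]
  calc (1 : ℝ) = ∫ v in (0 : ℝ)..1, (Real.exp (-w) + w * Real.exp (-(v * w))) := by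
        rw [hint]; simp
    _ ≤ _ := by
        refine intervalIntegral.integral_mono_on zero_le_one
          (Continuous.intervalIntegrable (by fun_prop) _ _)
          (Continuous.intervalIntegrable (by fun_prop) _ _) fun v hv => ?_
        have : Real.exp (-w) ≤ Real.exp (-(v * w)) :=
          Real.exp_le_exp.2 (by nlinarith [hv.2])
        linarith

theorem one_le_mul_integral_one_sub_mul_exp (w : ℝ) (hw : 0 ≤ w) :
    1 ≤ (2 + 2 * w) * ∫ v in (0 : ℝ)..1, (1 - v) * Real.exp (-(v * w)) := by
  have hd (v : ℝ) : HasDerivAt (fun v => -2 * ((1 - v) * Real.exp (-(v * w))) - v ^ 2)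
      (2 * (1 + (1 - v) * w) * Real.exp (-(v * w)) - 2 * v) v := by
    refine (((((hasDerivAt_id v).const_sub 1).mul
      (((hasDerivAt_id v).mul_const w).neg.exp)).const_mul (-2)).sub
      ((hasDerivAt_id v).pow 2)).congr_deriv ?_
    simp only [Pi.neg_apply, id_eq]
    push_cast
    ring
  have hint := intervalIntegral.integral_eq_sub_of_hasDerivAt (a := 0) (b := 1)
    (fun v _ => hd v) (Continuous.intervalIntegrable (by fun_prop) _ _)
  rw [← intervalIntegral.integral_const_mul]
  calc (1 : ℝ) = ∫ v in (0 : ℝ)..1,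
        (2 * (1 + (1 - v) * w) * Real.exp (-(v * w)) - 2 * v) := by
        rw [hint]; norm_num
    _ ≤ _ := by
        refine intervalIntegral.integral_mono_on zero_le_one
          (Continuous.intervalIntegrable (by fun_prop) _ _)
          (Continuous.intervalIntegrable (by fun_prop) _ _) fun v hv => ?_
        have : Real.exp (-(v * w)) ≤ 1 :=
          Real.exp_le_one_iff.2 (by nlinarith [mul_nonneg hv.1 hw])
        nlinarith [mul_le_mul_of_nonneg_left this hv.1]

/-- If the logistic derivative is averaged against a weight `p` along a segment, the average is at
least `c⁻¹` times its value at the starting point, where `c` normalizes the exponential average. -/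
theorem inv_mul_logisticDeriv_le_integral (p : ℝ → ℝ) (hp : Continuous p)
    (hp0 : ∀ v ∈ Set.Icc (0 : ℝ) 1, 0 ≤ p v) (z w c : ℝ) (hc : 0 < c)
    (h : 1 ≤ c * ∫ v in (0 : ℝ)..1, p v * Real.exp (-(v * |w|))) :
    c⁻¹ * logisticDeriv z ≤ ∫ v in (0 : ℝ)..1, p v * logisticDeriv (z + v * w) := by
  have hcont := continuous_logisticDeriv
  calc c⁻¹ * logisticDeriv z
      ≤ (∫ v in (0 : ℝ)..1, p v * Real.exp (-(v * |w|))) * logisticDeriv z := by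
        gcongr
        · exact logisticDeriv_nonneg z
        · exact (inv_le_iff_one_le_mul₀' hc).2 h
    _ = ∫ v in (0 : ℝ)..1, p v * Real.exp (-(v * |w|)) * logisticDeriv z :=
        (intervalIntegral.integral_mul_const _ _).symm
    _ ≤ _ := by
        refine intervalIntegral.integral_mono_on zero_le_one
          (Continuous.intervalIntegrable (by fun_prop) _ _)
          (Continuous.intervalIntegrable (by fun_prop) _ _) fun v hv => ?_
        have hsc := exp_neg_abs_mul_logisticDeriv_le z (v * w)
        rw [abs_mul, abs_of_nonneg hv.1] at hsc
        rw [mul_assoc]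
        exact mul_le_mul_of_nonneg_left hsc (hp0 v hv)

theorem inv_mul_logisticDeriv_le_integral_left (z w u : ℝ) (hwu : |w| ≤ u) :
    (1 + 2 * u)⁻¹ * logisticDeriv z ≤ ∫ v in (0 : ℝ)..1, logisticDeriv (z + v * w) := by
  have hw := abs_nonneg w
  have h := inv_mul_logisticDeriv_le_integral (fun _ => 1) continuous_const
    (fun _ _ => zero_le_one) z w (1 + |w|) (by positivity)
    (by simpa using one_le_mul_integral_exp |w| hw)
  simp only [one_mul] at h
  refine le_trans ?_ h
  gcongr
  · exact logisticDeriv_nonneg z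
  · linarith

theorem inv_mul_logisticDeriv_le_integral_right (z w u : ℝ) (hwu : |w| ≤ u) :
    (1 + 2 * u)⁻¹ * logisticDeriv (z + w) ≤
      ∫ v in (0 : ℝ)..1, logisticDeriv (z + v * w) := by
  have h := inv_mul_logisticDeriv_le_integral_left (z + w) (-w) u (by rwa [abs_neg])
  have hrefl := intervalIntegral.integral_comp_sub_left (a := 0) (b := 1)
    (fun v => logisticDeriv (z + v * w)) 1
  simp only [sub_self, sub_zero] at hrefl
  rw [← hrefl]
  convert h using 4
  ring

theorem inv_mul_logisticDeriv_le_integral_one_sub (z w u : ℝ) (hwu : |w| ≤ u) :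
    (2 + 2 * u)⁻¹ * logisticDeriv z ≤
      ∫ v in (0 : ℝ)..1, (1 - v) * logisticDeriv (z + v * w) := by
  have hw := abs_nonneg w
  refine le_trans ?_ (inv_mul_logisticDeriv_le_integral (fun v => 1 - v) (by fun_prop)
    (fun v hv => sub_nonneg.2 hv.2) z w (2 + 2 * |w|) (by positivity)
    (one_le_mul_integral_one_sub_mul_exp |w| hw))
  gcongr
  exact logisticDeriv_nonneg z

/-- Regularized Gram matrices compare when their weights do. -/
theorem posSemidef_regularizedGram_sub {ι m : Type*} [Fintype ι] [Fintype m] [DecidableEq m]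
    (x : ι → m → ℝ) (lam c : ℝ) (hlam : 0 ≤ lam) (hc : c ≤ 1) (a b : ι → ℝ)
    (hab : ∀ i, c * b i ≤ a i) :
    ((lam • (1 : Matrix m m ℝ) + ∑ i, a i • vecMulVec (x i) (x i)) -
      c • (lam • (1 : Matrix m m ℝ) + ∑ i, b i • vecMulVec (x i) (x i))).PosSemidef := by
  have heq : ((lam • (1 : Matrix m m ℝ) + ∑ i, a i • vecMulVec (x i) (x i)) -
      c • (lam • (1 : Matrix m m ℝ) + ∑ i, b i • vecMulVec (x i) (x i))) =
      ((1 - c) * lam) • (1 : Matrix m m ℝ) +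
        ∑ i, (a i - c * b i) • vecMulVec (x i) (x i) := by
    simp only [smul_add, Finset.smul_sum, smul_smul, sub_mul, sub_smul, one_mul,
      Finset.sum_sub_distrib]
    abel
  rw [heq]
  refine (PosSemidef.one.smul (mul_nonneg (sub_nonneg.2 hc) hlam)).add
    (posSemidef_sum _ fun i _ => PosSemidef.smul ?_ (sub_nonneg.2 (hab i)))
  simpa using posSemidef_vecMulVec_self_star (x i)

/-- Self-concordance control of the design matrices: with
`α(x,θ₁,θ₂) = ∫₀¹ μ̇(xᵀθ₁ + v xᵀ(θ₂−θ₁)) dv`,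
`α̃(x,θ₁,θ₂) = ∫₀¹ (1−v) μ̇(xᵀθ₁ + v xᵀ(θ₂−θ₁)) dv`,
`G = λI + Σᵢ α(xᵢ,θ₁,θ₂) xᵢxᵢᵀ`, `G̃ = λI + Σᵢ α̃(xᵢ,θ₁,θ₂) xᵢxᵢᵀ`,
`H(θ) = λI + Σᵢ μ̇(xᵢᵀθ) xᵢxᵢᵀ` and `u = maxᵢ |xᵢᵀ(θ₁−θ₂)|`, we have
`G ⪰ (1+2u)⁻¹ H(θ)` for `θ ∈ {θ₁,θ₂}` and `G̃ ⪰ (2+2u)⁻¹ H(θ₁)`. -/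
theorem selfconcordance_matrix_control {d n : ℕ}
    (θ₁ θ₂ : Fin d → ℝ) (x : Fin n → Fin d → ℝ) (lam : ℝ) (hlam : 0 < lam)
    (u : ℝ) (hu : u = ⨆ i : Fin n, |x i ⬝ᵥ (θ₁ - θ₂)|)
    (G Gt : Matrix (Fin d) (Fin d) ℝ) (H : (Fin d → ℝ) → Matrix (Fin d) (Fin d) ℝ)
    (hG : G = lam • (1 : Matrix (Fin d) (Fin d) ℝ) +
      ∑ i, (∫ v in (0:ℝ)..1, logisticDeriv (x i ⬝ᵥ θ₁ + v * (x i ⬝ᵥ (θ₂ - θ₁)))) •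
        vecMulVec (x i) (x i))
    (hGt : Gt = lam • (1 : Matrix (Fin d) (Fin d) ℝ) +
      ∑ i, (∫ v in (0:ℝ)..1,
          (1 - v) * logisticDeriv (x i ⬝ᵥ θ₁ + v * (x i ⬝ᵥ (θ₂ - θ₁)))) •
        vecMulVec (x i) (x i))
    (hH : ∀ θ, H θ = lam • (1 : Matrix (Fin d) (Fin d) ℝ) +
      ∑ i, logisticDeriv (x i ⬝ᵥ θ) • vecMulVec (x i) (x i)) :
    (∀ θ ∈ ({θ₁, θ₂} : Set (Fin d → ℝ)), (G - (1 + 2 * u)⁻¹ • H θ).PosSemidef) ∧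
      (Gt - (2 + 2 * u)⁻¹ • H θ₁).PosSemidef := by
  have hu0 : 0 ≤ u := hu ▸ Real.iSup_nonneg fun i => abs_nonneg _
  have hle (i : Fin n) : |x i ⬝ᵥ (θ₂ - θ₁)| ≤ u := by
    rw [hu, ← neg_sub θ₁ θ₂, dotProduct_neg, abs_neg]
    exact le_ciSup (f := fun i => |x i ⬝ᵥ (θ₁ - θ₂)|) (Set.finite_range _).bddAbove i
  subst hG hGt
  refine ⟨?_, ?_⟩
  · rintro θ (rfl | rfl) <;> rw [hH]
    · exact posSemidef_regularizedGram_sub x lam _ hlam.le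
        (inv_le_one_of_one_le₀ (by linarith)) _ _ fun i =>
        inv_mul_logisticDeriv_le_integral_left _ _ _ (hle i)
    · refine posSemidef_regularizedGram_sub x lam _ hlam.le
        (inv_le_one_of_one_le₀ (by linarith)) _ _ fun i => ?_
      have h := inv_mul_logisticDeriv_le_integral_right (x i ⬝ᵥ θ₁) _ _ (hle i)
      rwa [← dotProduct_add, add_sub_cancel] at h
  · rw [hH]
    exact posSemidef_regularizedGram_sub x lam _ hlam.le
      (inv_le_one_of_one_le₀ (by linarith)) _ _ fun i =>
      inv_mul_logisticDeriv_le_integral_one_sub _ _ _ (hle i)
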